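/- For every natural number n, the function (x,y,z) ↦ (x(1−x)y(1−y)z(1−z)/(1−(1−xy)z))ⁿ · 1/(1−(1−xy)z) is Lebesgue integrable on the open unit cube (0,1)³, and moreover 𝔍'_n ≤ 2·(1/24)ⁿ·ζ(3). -/

import Mathlib

open MeasureTheory

/-- `𝔍' n = ∫_{(x,y,z)∈(0,1)³} (x(1-x)y(1-y)z(1-z)/(1-(1-yz)x))ⁿ · 1/(1-(1-yz)x) dμ`,
where the triple `(x, y, z)` is encoded as `(p.1, p.2.1, p.2.2)`. -/
noncomputable def JJ' (n : ℕ) : ℝ :=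
  ∫ p : ℝ × ℝ × ℝ in Set.Ioo (0 : ℝ) 1 ×ˢ Set.Ioo (0 : ℝ) 1 ×ˢ Set.Ioo (0 : ℝ) 1,
    (p.1 * (1 - p.1) * p.2.1 * (1 - p.2.1) * p.2.2 * (1 - p.2.2) /
        (1 - (1 - p.2.1 * p.2.2) * p.1)) ^ n / (1 - (1 - p.2.1 * p.2.2) * p.1)

theorem mul_one_sub_sq_le {y : ℝ} (hy : y ≤ 1) : y * (1 - y) ^ 2 ≤ 4 / 27 := by
  nlinarith [mul_nonneg (sq_nonneg (3 * y - 1)) (by linarith : (0 : ℝ) ≤ 4 - 3 * y)]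

theorem one_sub_one_sub_mul_pos {a t : ℝ} (ha : 0 < a) (ht : t ∈ Set.Ioo (0 : ℝ) 1) :
    0 < 1 - (1 - a) * t := by
  nlinarith [mul_pos ha ht.1, ht.2]

theorem beukers_factor_le {x y z : ℝ} (hx : x ∈ Set.Ioo (0 : ℝ) 1) (hy : y ∈ Set.Ioo (0 : ℝ) 1)
    (hz : z ∈ Set.Ioo (0 : ℝ) 1) :
    x * (1 - x) * y * (1 - y) * z * (1 - z) / (1 - (1 - y * z) * x) ≤ 1 / 24 := by
  have hD := one_sub_one_sub_mul_pos (mul_pos hy.1 hz.1) hx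
  rw [div_le_iff₀ hD]
  have hY := mul_one_sub_sq_le hy.2.le
  have hZ := mul_one_sub_sq_le hz.2.le
  obtain ⟨hx0, hx1⟩ := hx
  obtain ⟨hy0, hy1⟩ := hy
  obtain ⟨hz0, hz1⟩ := hz
  have hX : x * (1 - x) ≤ 1 / 4 := by nlinarith [sq_nonneg (2 * x - 1)]
  have hX0 : 0 ≤ x * (1 - x) := mul_nonneg hx0.le (by linarith)
  have hyz : 0 ≤ y * z := by positivity
  have hYZ : (y * (1 - y) ^ 2) * (z * (1 - z) ^ 2) ≤ 4 / 27 * (4 / 27) :=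
    mul_le_mul hY hZ (by positivity) (by norm_num)
  have hXYZ : (x * (1 - x)) * ((y * (1 - y) ^ 2) * (z * (1 - z) ^ 2)) ≤
      1 / 4 * (4 / 27 * (4 / 27)) :=
    mul_le_mul hX hYZ (by positivity) (by norm_num)
  have hamgm : 4 * (x * (1 - x)) * (y * z) ≤ (1 - (1 - y * z) * x) ^ 2 := by
    nlinarith [sq_nonneg ((1 - x) - x * y * z)]
  refine le_of_sq_le_sq ?_ (by positivity)
  calc (x * (1 - x) * y * (1 - y) * z * (1 - z)) ^ 2
      = (x * (1 - x)) * ((y * (1 - y) ^ 2) * (z * (1 - z) ^ 2)) * ((x * (1 - x)) * (y * z)) := by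
        ring
    _ ≤ 1 / 4 * (4 / 27 * (4 / 27)) * ((x * (1 - x)) * (y * z)) := by gcongr
    _ ≤ (1 / 24 * (1 - (1 - y * z) * x)) ^ 2 := by
        nlinarith [mul_nonneg hX0 hyz]

theorem lintegral_Ioo_eq_of_hasDerivAt {F f : ℝ → ℝ} (hF : ContinuousOn F (Set.Icc 0 1))
    (hderiv : ∀ x ∈ Set.Ioo (0 : ℝ) 1, HasDerivAt F (f x) x)
    (hf : ∀ x ∈ Set.Ioo (0 : ℝ) 1, 0 ≤ f x) :
    ∫⁻ x in Set.Ioo (0 : ℝ) 1, ENNReal.ofReal (f x) = ENNReal.ofReal (F 1 - F 0) := by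
  have hint : IntegrableOn f (Set.Ioc 0 1) :=
    intervalIntegral.integrableOn_deriv_of_nonneg hF hderiv hf
  have hval := intervalIntegral.integral_eq_sub_of_hasDerivAt_of_le zero_le_one hF hderiv
    ((intervalIntegrable_iff_integrableOn_Ioc_of_le zero_le_one).2 hint)
  rw [intervalIntegral.integral_of_le zero_le_one, integral_Ioc_eq_integral_Ioo] at hval
  rw [← hval, ofReal_integral_eq_lintegral_ofReal (hint.mono_set Set.Ioo_subset_Ioc_self)]
  exact (ae_restrict_mem measurableSet_Ioo).mono hf

theorem lintegral_Ioo_pow (k : ℕ) :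
    ∫⁻ x in Set.Ioo (0 : ℝ) 1, ENNReal.ofReal (x ^ k) = ENNReal.ofReal (1 / ((k : ℝ) + 1)) := by
  have hk : (k : ℝ) + 1 ≠ 0 := by positivity
  rw [lintegral_Ioo_eq_of_hasDerivAt (F := fun x ↦ x ^ (k + 1) / ((k : ℝ) + 1))
    (by fun_prop) (fun x _ ↦ ?_) (fun x hx ↦ pow_nonneg hx.1.le k)]
  · simp
  · refine ((hasDerivAt_pow (k + 1) x).div_const ((k : ℝ) + 1)).congr_deriv ?_
    push_cast
    exact mul_div_cancel_left₀ _ hk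

theorem lintegral_Ioo_pow_mul_neg_log (k : ℕ) :
    ∫⁻ x in Set.Ioo (0 : ℝ) 1, ENNReal.ofReal (x ^ k * -Real.log x) =
      ENNReal.ofReal (1 / ((k : ℝ) + 1) ^ 2) := by
  have hk : (k : ℝ) + 1 ≠ 0 := by positivity
  rw [lintegral_Ioo_eq_of_hasDerivAt
    (F := fun x ↦ x ^ (k + 1) / ((k : ℝ) + 1) ^ 2 - x ^ k * (x * Real.log x) / ((k : ℝ) + 1))
    ?_ (fun x hx ↦ ?_)
    (fun x hx ↦ mul_nonneg (pow_nonneg hx.1.le k)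
      (neg_nonneg.2 (Real.log_nonpos hx.1.le hx.2.le)))]
  · simp
  · have := Real.continuous_mul_log
    fun_prop
  · have hx0 : x ≠ 0 := hx.1.ne'
    have h := ((hasDerivAt_pow (k + 1) x).div_const (((k : ℝ) + 1) ^ 2)).sub
      (((hasDerivAt_pow (k + 1) x).mul (Real.hasDerivAt_log hx0)).div_const ((k : ℝ) + 1))
    refine (h.congr_of_eventuallyEq (.of_forall fun u ↦ ?_)).congr_deriv ?_
    · dsimp
      ring
    · push_cast
      field_simp
      ring

theorem lintegral_Ioo_one_div {a : ℝ} (ha : a ∈ Set.Ioo (0 : ℝ) 1) :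
    ∫⁻ t in Set.Ioo (0 : ℝ) 1, ENNReal.ofReal (1 / (1 - (1 - a) * t)) =
      ∑' k : ℕ, ENNReal.ofReal (a ^ k * -Real.log a) := by
  have ha1 : 1 - a ≠ 0 := by linarith [ha.2]
  have hlog : 0 ≤ -Real.log a := neg_nonneg.2 (Real.log_nonpos ha.1.le ha.2.le)
  have hpos : ∀ t ∈ Set.Icc (0 : ℝ) 1, 1 - (1 - a) * t ≠ 0 := fun t ht ↦ by
    nlinarith [ht.1, ht.2, ha.1, ha.2]
  rw [lintegral_Ioo_eq_of_hasDerivAt (F := fun t ↦ -Real.log (1 - (1 - a) * t) / (1 - a))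
    ?_ (fun t ht ↦ ?_) (fun t ht ↦ (one_div_pos.2 (one_sub_one_sub_mul_pos ha.1 ht)).le)]
  · have hs := (hasSum_geometric_of_lt_one ha.1.le ha.2).mul_right (-Real.log a)
    rw [← ENNReal.ofReal_tsum_of_nonneg (fun k ↦ mul_nonneg (pow_nonneg ha.1.le k) hlog)
      hs.summable, hs.tsum_eq]
    congr 1
    simp
    ring
  · exact ((ContinuousOn.log (by fun_prop) hpos).neg).div_const _
  · have ht0 := hpos t (Set.Ioo_subset_Icc_self ht)
    have h := (((((hasDerivAt_id t).const_mul (1 - a)).const_sub 1).log ht0).neg).div_const (1 - a)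
    refine h.congr_deriv ?_
    simp only [id]
    field_simp

theorem lintegral_lintegral_one_div :
    ∫⁻ x in Set.Ioo (0 : ℝ) 1, ∫⁻ y in Set.Ioo (0 : ℝ) 1, ∫⁻ t in Set.Ioo (0 : ℝ) 1,
        ENNReal.ofReal (1 / (1 - (1 - x * y) * t)) =
      ENNReal.ofReal (2 * ∑' m : ℕ, 1 / ((m : ℝ) + 1) ^ 3) := by
  have hexpand : ∀ x ∈ Set.Ioo (0 : ℝ) 1, ∀ y ∈ Set.Ioo (0 : ℝ) 1,
      ∫⁻ t in Set.Ioo (0 : ℝ) 1, ENNReal.ofReal (1 / (1 - (1 - x * y) * t)) =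
        ∑' k : ℕ, (ENNReal.ofReal (x ^ k * -Real.log x) * ENNReal.ofReal (y ^ k) +
          ENNReal.ofReal (x ^ k) * ENNReal.ofReal (y ^ k * -Real.log y)) := by
    intro x hx y hy
    rw [lintegral_Ioo_one_div ⟨mul_pos hx.1 hy.1, by nlinarith [hx.1, hx.2, hy.1, hy.2]⟩]
    refine tsum_congr fun k ↦ ?_
    have hxk := pow_nonneg hx.1.le k
    have hyk := pow_nonneg hy.1.le k
    have hlx : 0 ≤ -Real.log x := neg_nonneg.2 (Real.log_nonpos hx.1.le hx.2.le)
    have hly : 0 ≤ -Real.log y := neg_nonneg.2 (Real.log_nonpos hy.1.le hy.2.le)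
    rw [← ENNReal.ofReal_mul (by positivity), ← ENNReal.ofReal_mul hxk,
      ← ENNReal.ofReal_add (by positivity) (by positivity),
      Real.log_mul hx.1.ne' hy.1.ne', mul_pow]
    congr 1
    ring
  have hinner : ∀ x ∈ Set.Ioo (0 : ℝ) 1,
      ∫⁻ y in Set.Ioo (0 : ℝ) 1, ∫⁻ t in Set.Ioo (0 : ℝ) 1,
        ENNReal.ofReal (1 / (1 - (1 - x * y) * t)) =
        ∑' k : ℕ, (ENNReal.ofReal (x ^ k * -Real.log x) * ENNReal.ofReal (1 / ((k : ℝ) + 1)) +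
          ENNReal.ofReal (x ^ k) * ENNReal.ofReal (1 / ((k : ℝ) + 1) ^ 2)) := by
    intro x hx
    rw [setLIntegral_congr_fun measurableSet_Ioo (hexpand x hx),
      lintegral_tsum (fun k ↦ by fun_prop)]
    refine tsum_congr fun k ↦ ?_
    rw [lintegral_add_left (by fun_prop), lintegral_const_mul _ (by fun_prop),
      lintegral_const_mul _ (by fun_prop), lintegral_Ioo_pow, lintegral_Ioo_pow_mul_neg_log]
  rw [setLIntegral_congr_fun measurableSet_Ioo hinner, lintegral_tsum (fun k ↦ by fun_prop),
    ← tsum_mul_left, ENNReal.ofReal_tsum_of_nonneg (fun k ↦ by positivity)]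
  · refine tsum_congr fun k ↦ ?_
    rw [lintegral_add_left (by fun_prop), lintegral_mul_const _ (by fun_prop),
      lintegral_mul_const _ (by fun_prop), lintegral_Ioo_pow, lintegral_Ioo_pow_mul_neg_log,
      ← ENNReal.ofReal_mul (by positivity), ← ENNReal.ofReal_mul (by positivity),
      ← ENNReal.ofReal_add (by positivity) (by positivity)]
    congr 1
    field_simp
    ring
  · refine Summable.mul_left 2 ?_
    exact_mod_cast (summable_nat_add_iff 1).2 (Real.summable_one_div_nat_pow.2 (by norm_num : 1 < 3))

theorem integrable_and_integral_le_of_lintegral_le {α : Type*} [MeasurableSpace α] {μ : Measure α}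
    {f g : α → ℝ} {C M : ℝ} (hf : AEStronglyMeasurable f μ) (hC : 0 ≤ C) (hM : 0 ≤ M)
    (hf0 : 0 ≤ᵐ[μ] f) (hfg : ∀ᵐ x ∂μ, f x ≤ C * g x)
    (hg : ∫⁻ x, ENNReal.ofReal (g x) ∂μ ≤ ENNReal.ofReal M) :
    Integrable f μ ∧ ∫ x, f x ∂μ ≤ C * M := by
  have hle : ∫⁻ x, ENNReal.ofReal (f x) ∂μ ≤ ENNReal.ofReal (C * M) := by
    calc ∫⁻ x, ENNReal.ofReal (f x) ∂μ
        ≤ ∫⁻ x, ENNReal.ofReal C * ENNReal.ofReal (g x) ∂μ := by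
          refine lintegral_mono_ae (hfg.mono fun x hx ↦ ?_)
          rw [← ENNReal.ofReal_mul hC]
          exact ENNReal.ofReal_le_ofReal hx
      _ = ENNReal.ofReal C * ∫⁻ x, ENNReal.ofReal (g x) ∂μ :=
          lintegral_const_mul' _ _ ENNReal.ofReal_ne_top
      _ ≤ ENNReal.ofReal (C * M) := by
          rw [ENNReal.ofReal_mul hC]
          gcongr
  refine ⟨⟨hf, ?_⟩, ?_⟩
  · rw [hasFiniteIntegral_iff_ofReal hf0]
    exact hle.trans_lt ENNReal.ofReal_lt_top
  · rw [integral_eq_lintegral_of_nonneg_ae hf0 hf]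
    exact ENNReal.toReal_le_of_le_ofReal (mul_nonneg hC hM) hle

theorem beukers_integrand_nonneg_and_le {x y z : ℝ} (hx : x ∈ Set.Ioo (0 : ℝ) 1)
    (hy : y ∈ Set.Ioo (0 : ℝ) 1) (hz : z ∈ Set.Ioo (0 : ℝ) 1) (n : ℕ) :
    0 ≤ (x * (1 - x) * y * (1 - y) * z * (1 - z) / (1 - (1 - y * z) * x)) ^ n /
        (1 - (1 - y * z) * x) ∧
    (x * (1 - x) * y * (1 - y) * z * (1 - z) / (1 - (1 - y * z) * x)) ^ n /
        (1 - (1 - y * z) * x) ≤ (1 / 24) ^ n * (1 / (1 - (1 - y * z) * x)) := by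
  have hD := one_sub_one_sub_mul_pos (mul_pos hy.1 hz.1) hx
  have hle := beukers_factor_le hx hy hz
  have hx1 := sub_nonneg.2 hx.2.le
  have hy1 := sub_nonneg.2 hy.2.le
  have hz1 := sub_nonneg.2 hz.2.le
  have hx0 := hx.1
  have hy0 := hy.1
  have hz0 := hz.1
  have h0 : 0 ≤ x * (1 - x) * y * (1 - y) * z * (1 - z) / (1 - (1 - y * z) * x) :=
    div_nonneg (by positivity) hD.le
  refine ⟨by positivity, ?_⟩
  rw [div_eq_mul_one_div]
  gcongr

theorem integrableOn_JJ'_and_JJ'_upper (n : ℕ) :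
    Integrable
      (fun p : ℝ × ℝ × ℝ ↦
        (p.1 * (1 - p.1) * p.2.1 * (1 - p.2.1) * p.2.2 * (1 - p.2.2) /
            (1 - (1 - p.1 * p.2.1) * p.2.2)) ^ n / (1 - (1 - p.1 * p.2.1) * p.2.2))
      (volume.restrict (Set.Ioo (0 : ℝ) 1 ×ˢ Set.Ioo (0 : ℝ) 1 ×ˢ Set.Ioo (0 : ℝ) 1)) ∧
    JJ' n ≤ 2 * (1 / 24) ^ n * ∑' m : ℕ, 1 / ((m : ℝ) + 1) ^ 3 := by
  have hM : 0 ≤ 2 * ∑' m : ℕ, 1 / ((m : ℝ) + 1) ^ 3 :=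
    mul_nonneg zero_le_two (tsum_nonneg fun m ↦ by positivity)
  have hC : (0 : ℝ) ≤ (1 / 24) ^ n := by positivity
  have hmem := ae_restrict_mem (μ := (volume : Measure (ℝ × ℝ × ℝ)))
    (measurableSet_Ioo.prod (measurableSet_Ioo.prod measurableSet_Ioo) :
      MeasurableSet (Set.Ioo (0 : ℝ) 1 ×ˢ Set.Ioo (0 : ℝ) 1 ×ˢ Set.Ioo (0 : ℝ) 1))
  have hprod : (volume : Measure (ℝ × ℝ × ℝ)).restrict
      (Set.Ioo (0 : ℝ) 1 ×ˢ Set.Ioo (0 : ℝ) 1 ×ˢ Set.Ioo (0 : ℝ) 1) =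
      (volume.restrict (Set.Ioo (0 : ℝ) 1)).prod
        ((volume.restrict (Set.Ioo (0 : ℝ) 1)).prod (volume.restrict (Set.Ioo (0 : ℝ) 1))) := by
    rw [Measure.prod_restrict, Measure.prod_restrict]
    rfl
  have hcycle (x y z : ℝ) : z * (1 - z) * x * (1 - x) * y * (1 - y) =
      x * (1 - x) * y * (1 - y) * z * (1 - z) := by ring
  constructor
  · refine (integrable_and_integral_le_of_lintegral_le
      (g := fun p : ℝ × ℝ × ℝ ↦ 1 / (1 - (1 - p.1 * p.2.1) * p.2.2))
      (Measurable.aestronglyMeasurable (by fun_prop)) hC hM ?_ ?_ ?_).1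
    · filter_upwards [hmem] with p hp
      have h := (beukers_integrand_nonneg_and_le hp.2.2 hp.1 hp.2.1 n).1
      rwa [hcycle] at h
    · filter_upwards [hmem] with p hp
      have h := (beukers_integrand_nonneg_and_le hp.2.2 hp.1 hp.2.1 n).2
      rwa [hcycle] at h
    · rw [hprod, ← lintegral_lintegral_one_div, lintegral_prod _ (by fun_prop)]
      refine (lintegral_congr fun x ↦ ?_).le
      rw [lintegral_prod _ (by fun_prop)]
  · rw [mul_comm (2 : ℝ), mul_assoc]
    refine (integrable_and_integral_le_of_lintegral_le
      (g := fun p : ℝ × ℝ × ℝ ↦ 1 / (1 - (1 - p.2.1 * p.2.2) * p.1))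
      (Measurable.aestronglyMeasurable (by fun_prop)) hC hM ?_ ?_ ?_).2
    · filter_upwards [hmem] with p hp
      exact (beukers_integrand_nonneg_and_le hp.1 hp.2.1 hp.2.2 n).1
    · filter_upwards [hmem] with p hp
      exact (beukers_integrand_nonneg_and_le hp.1 hp.2.1 hp.2.2 n).2
    · rw [hprod, ← lintegral_lintegral_one_div, lintegral_prod_symm _ (by fun_prop),
        lintegral_prod _ (Measurable.aemeasurable ?_)]
      exact Measurable.lintegral_prod_left' (f := fun q : ℝ × ℝ × ℝ ↦
        ENNReal.ofReal (1 / (1 - (1 - q.2.1 * q.2.2) * q.1))) (by fun_prop)
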